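/- Let d be a prime number with d ≠ 3. Let U be a d×d unitary matrix, F a 2×2 integer matrix with det F ≡ 1 (mod d̄), and χ ∈ ℤ², and suppose that U D_p U† = ω^{⟨χ, Fp⟩} D_{Fp} for all p ∈ ℤ². If U³ is a scalar multiple of the identity but neither U nor U² is a scalar multiple of the identity (i.e. the Clifford operation determined by U has order 3), then trace F ≡ −1 (mod d). -/

import Mathlib

noncomputable section
open Matrix Complex

/-- `d̄ = d` for odd `d`, `2d` for even `d`. -/
def dbar (d : ℕ) : ℕ := if d % 2 = 1 then d else 2 * d

/-- `ω = exp(2πi/d)`. -/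
def omega (d : ℕ) : ℂ := Complex.exp (2 * Real.pi * Complex.I / d)

/-- `τ = −exp(πi/d)`. -/
def tau (d : ℕ) : ℂ := -Complex.exp (Real.pi * Complex.I / d)

/-- The diagonal matrix `T e_r = ω^r e_r`. -/
def Tmat (d : ℕ) : Matrix (Fin d) (Fin d) ℂ :=
  Matrix.diagonal fun r => omega d ^ (r : ℕ)

/-- The cyclic shift `S e_r = e_{r+1 mod d}`. -/
def Smat (d : ℕ) : Matrix (Fin d) (Fin d) ℂ :=
  Matrix.of fun r s => if (r : ℕ) = ((s : ℕ) + 1) % d then 1 else 0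

/-- The displacement operators `D_p = τ^{p₁p₂} S^{p₁} T^{p₂}`. -/
def Dmat (d : ℕ) (p : ℤ × ℤ) : Matrix (Fin d) (Fin d) ℂ :=
  tau d ^ (p.1 * p.2) • (Smat d ^ p.1 * Tmat d ^ p.2)

/-- The symplectic form `⟨p,q⟩ = p₂q₁ − p₁q₂`. -/
def symp (p q : ℤ × ℤ) : ℤ := p.2 * q.1 - p.1 * q.2

/-- Action of a 2×2 integer matrix on `ℤ²`. -/
def Fapp (F : Matrix (Fin 2) (Fin 2) ℤ) (p : ℤ × ℤ) : ℤ × ℤ :=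
  (F 0 0 * p.1 + F 0 1 * p.2, F 1 0 * p.1 + F 1 1 * p.2)

/-- The generalized Pauli group `W(d) = {e^{iξ} D_p}`, as a set of matrices. -/
def Wset (d : ℕ) : Set (Matrix (Fin d) (Fin d) ℂ) :=
  {M | ∃ ξ : ℝ, ∃ p : ℤ × ℤ, M = Complex.exp (ξ * Complex.I) • Dmat d p}

section Clifford

variable {d : ℕ}

lemma isPrimitiveRoot_omega (hd : d ≠ 0) : IsPrimitiveRoot (omega d) d :=
  Complex.isPrimitiveRoot_exp d hd

lemma omega_ne_zero : omega d ≠ 0 := Complex.exp_ne_zero _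

lemma tau_ne_zero : tau d ≠ 0 := neg_ne_zero.mpr (Complex.exp_ne_zero _)

lemma Tmat_pow (hd : d ≠ 0) : Tmat d ^ d = 1 := by
  rw [Tmat, Matrix.diagonal_pow, ← Matrix.diagonal_one]
  congr 1
  funext r
  simp [pow_right_comm, (isPrimitiveRoot_omega hd).pow_eq_one]

lemma Smat_pow_apply [NeZero d] (n : ℕ) (r s : Fin d) :
    (Smat d ^ n) r s = if (r : ℕ) = ((s : ℕ) + n) % d then 1 else 0 := by
  induction n generalizing r s with
  | zero => simp [Matrix.one_apply, Fin.ext_iff, Nat.mod_eq_of_lt s.isLt]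
  | succ n ih =>
    have hlt : ((s : ℕ) + 1) % d < d := Nat.mod_lt _ (NeZero.pos d)
    rw [pow_succ, Matrix.mul_apply, Finset.sum_eq_single ⟨((s : ℕ) + 1) % d, hlt⟩]
    · rw [ih]
      simp [Smat, Nat.add_assoc, Nat.add_comm 1 n]
    · intro j _ hj
      have hj' : (j : ℕ) ≠ ((s : ℕ) + 1) % d := fun h => hj (Fin.ext h)
      simp [Smat, hj']
    · simp

lemma Smat_pow [NeZero d] : Smat d ^ d = 1 := by
  ext r s
  simp [Smat_pow_apply, Matrix.one_apply, Fin.ext_iff, Nat.mod_eq_of_lt s.isLt]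

lemma isUnit_det_of_pow_eq_one {n : Type*} [Fintype n] [DecidableEq n] {A : Matrix n n ℂ} {k : ℕ}
    (hk : k ≠ 0) (h : A ^ k = 1) : IsUnit A.det :=
  (Matrix.isUnit_iff_isUnit_det A).mp (IsUnit.of_pow_eq_one h hk)

lemma isUnit_det_Tmat (hd : d ≠ 0) : IsUnit (Tmat d).det :=
  isUnit_det_of_pow_eq_one hd (Tmat_pow hd)

lemma isUnit_det_Smat [NeZero d] : IsUnit (Smat d).det :=
  isUnit_det_of_pow_eq_one (NeZero.ne d) Smat_pow

lemma Tmat_mul_Smat [NeZero d] : Tmat d * Smat d = omega d • (Smat d * Tmat d) := by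
  ext r s
  simp only [Tmat, Matrix.diagonal_mul, Matrix.smul_apply, Matrix.mul_diagonal, Smat,
    Matrix.of_apply, smul_eq_mul]
  split_ifs with h
  · rw [h, mul_one, one_mul, ← pow_succ', pow_eq_pow_mod (s + 1 : ℕ)
      (isPrimitiveRoot_omega (NeZero.ne d)).pow_eq_one]
  · simp

lemma Matrix.smul_one_zpow {n : Type*} [Fintype n] [DecidableEq n] {c : ℂ} (hc : c ≠ 0) (m : ℤ) :
    (c • (1 : Matrix n n ℂ)) ^ m = c ^ m • 1 := by
  have h : IsUnit (c • (1 : Matrix n n ℂ)).det := by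
    simp [hc]
  induction m with
  | zero => simp
  | succ k ih => rw [Matrix.zpow_add_one h, ih, zpow_add_one₀ hc]; simp [smul_smul, mul_comm]
  | pred k ih =>
    rw [Matrix.zpow_sub_one h, ih, zpow_sub_one₀ hc,
      Matrix.inv_eq_left_inv (B := c⁻¹ • (1 : Matrix n n ℂ)) (by simp [smul_smul, hc])]
    simp [smul_smul, mul_comm]

lemma Matrix.mul_zpow_of_mul_eq_smul {n : Type*} [Fintype n] [DecidableEq n] {A X : Matrix n n ℂ}
    {c : ℂ} (hc : c ≠ 0) (hX : IsUnit X.det) (h : A * X = c • (X * A)) (m : ℤ) :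
    A * X ^ m = c ^ m • (X ^ m * A) := by
  have hY : IsUnit (c • X).det := by
    rw [Matrix.det_smul]
    exact (IsUnit.mk0 _ (pow_ne_zero _ hc)).mul hX
  have hs : SemiconjBy A X (c • X) := by simpa [SemiconjBy] using h
  have := (Matrix.SemiconjBy.zpow_right hX hY hs m).eq
  have hcX : c • X = (c • (1 : Matrix n n ℂ)) * X := by simp
  have hcomm : Commute (c • (1 : Matrix n n ℂ)) X := (Commute.one_left X).smul_left c
  rw [hcX, Matrix.Commute.mul_zpow hcomm, Matrix.smul_one_zpow hc] at this
  simpa using this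

lemma Tmat_mul_Dmat [NeZero d] (p : ℤ × ℤ) :
    Tmat d * Dmat d p = omega d ^ p.1 • (Dmat d p * Tmat d) := by
  have hT : Commute (Tmat d) (Tmat d ^ p.2) := Matrix.Commute.self_zpow _ _
  rw [Dmat, Matrix.mul_smul, ← mul_assoc, Matrix.mul_zpow_of_mul_eq_smul omega_ne_zero
    isUnit_det_Smat Tmat_mul_Smat, Matrix.smul_mul, mul_assoc, hT.eq, Matrix.smul_mul,
    smul_comm, mul_assoc]

lemma Smat_mul_Dmat [NeZero d] (p : ℤ × ℤ) :
    Smat d * Dmat d p = (omega d)⁻¹ ^ p.2 • (Dmat d p * Smat d) := by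
  have hS : Commute (Smat d) (Smat d ^ p.1) := Matrix.Commute.self_zpow _ _
  have h : Smat d * Tmat d = (omega d)⁻¹ • (Tmat d * Smat d) := by
    rw [Tmat_mul_Smat, smul_smul, inv_mul_cancel₀ omega_ne_zero, one_smul]
  rw [Dmat, Matrix.mul_smul, ← mul_assoc, hS.eq, mul_assoc, Matrix.mul_zpow_of_mul_eq_smul
    (inv_ne_zero omega_ne_zero) (isUnit_det_Tmat (NeZero.ne d)) h, Matrix.smul_mul,
    Matrix.mul_smul, smul_comm, mul_assoc]

lemma isUnit_det_Dmat [NeZero d] (p : ℤ × ℤ) : IsUnit (Dmat d p).det := by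
  rw [Dmat, Matrix.det_smul, Matrix.det_mul]
  exact (IsUnit.mk0 _ (pow_ne_zero _ (zpow_ne_zero _ tau_ne_zero))).mul
    ((isUnit_det_Smat.det_zpow p.1).mul ((isUnit_det_Tmat (NeZero.ne d)).det_zpow p.2))

lemma Dmat_mul_ne_zero [NeZero d] (p : ℤ × ℤ) {A : Matrix (Fin d) (Fin d) ℂ} (hA : IsUnit A.det) :
    Dmat d p * A ≠ 0 := by
  intro h
  have := (isUnit_det_Dmat (d := d) p).mul hA
  rw [← Matrix.det_mul, h, Matrix.det_zero] at this
  exact not_isUnit_zero this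

lemma omega_zpow_eq_iff [NeZero d] (a b : ℤ) :
    omega d ^ a = omega d ^ b ↔ (a : ZMod d) = b := by
  rw [← div_eq_one_iff_eq (zpow_ne_zero _ omega_ne_zero), ← zpow_sub₀ omega_ne_zero,
    (isPrimitiveRoot_omega (NeZero.ne d)).zpow_eq_one_iff_dvd, ← ZMod.intCast_zmod_eq_zero_iff_dvd,
    Int.cast_sub, sub_eq_zero]

/-- Displacement operators that are proportional have congruent labels. -/
lemma intCast_eq_of_Dmat_eq_smul [NeZero d] {p q : ℤ × ℤ} {z : ℂ} (h : Dmat d p = z • Dmat d q) :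
    (p.1 : ZMod d) = q.1 ∧ (p.2 : ZMod d) = q.2 := by
  have key {A : Matrix (Fin d) (Fin d) ℂ} (hA : IsUnit A.det) {x y : ℂ}
      (hp : A * Dmat d p = x • (Dmat d p * A)) (hq : A * Dmat d q = y • (Dmat d q * A)) :
      x = y := by
    have : x • (Dmat d p * A) = y • (Dmat d p * A) := by
      rw [← hp, h, Matrix.mul_smul, hq, smul_comm, Matrix.smul_mul]
    exact smul_left_injective ℂ (Dmat_mul_ne_zero p hA) this
  constructor
  · rw [← omega_zpow_eq_iff]
    exact key (isUnit_det_Tmat (NeZero.ne d)) (Tmat_mul_Dmat p) (Tmat_mul_Dmat q)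
  · rw [← omega_zpow_eq_iff]
    have := key isUnit_det_Smat (Smat_mul_Dmat p) (Smat_mul_Dmat q)
    rwa [_root_.inv_zpow, _root_.inv_zpow, _root_.inv_inj] at this

lemma Matrix.zpow_eq_of_intCast_eq {n : Type*} [Fintype n] [DecidableEq n] {A : Matrix n n ℂ}
    (hd : d ≠ 0) (hA : A ^ d = 1) {a b : ℤ} (h : (a : ZMod d) = b) : A ^ a = A ^ b := by
  obtain ⟨k, hk⟩ := (ZMod.intCast_eq_intCast_iff_dvd_sub b a d).mp h.symm
  obtain rfl : a = b + d * k := by lia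
  rw [Matrix.zpow_add (isUnit_det_of_pow_eq_one hd hA),
    Matrix.zpow_mul _ (isUnit_det_of_pow_eq_one hd hA), zpow_natCast, hA, Matrix.one_zpow, mul_one]

/-- A matrix commuting with the shift and clock matrices is scalar. -/
lemma exists_eq_smul_one_of_commute [NeZero d] {U : Matrix (Fin d) (Fin d) ℂ}
    (hS : Commute U (Smat d)) (hT : Commute U (Tmat d)) :
    ∃ c : ℂ, U = c • (1 : Matrix (Fin d) (Fin d) ℂ) := by
  have hdiag (r s : Fin d) (hrs : r ≠ s) : U r s = 0 := by
    have h := congrFun (congrFun hT.eq r) s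
    rw [Tmat, Matrix.mul_diagonal, Matrix.diagonal_mul, mul_comm] at h
    by_contra hne
    exact hrs (Fin.ext ((isPrimitiveRoot_omega (NeZero.ne d)).pow_inj s.isLt r.isLt
      (mul_right_cancel₀ hne h)).symm)
  have hconst (n : ℕ) (hn : n < d) : U ⟨n, hn⟩ ⟨n, hn⟩ = U 0 0 := by
    induction n with
    | zero => rfl
    | succ n ih =>
      have hn' : n < d := by lia
      have h := congrFun (congrFun hS.eq ⟨n + 1, hn⟩) ⟨n, hn'⟩
      rw [Matrix.mul_apply, Matrix.mul_apply, Finset.sum_eq_single ⟨n + 1, hn⟩,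
        Finset.sum_eq_single ⟨n, hn'⟩] at h
      · simpa [Smat, Nat.mod_eq_of_lt hn, ih hn'] using h
      · intro j _ hj
        rw [hdiag _ _ hj, mul_zero]
      · simp
      · intro j _ hj
        rw [hdiag _ _ hj.symm, zero_mul]
      · simp
  refine ⟨U 0 0, ?_⟩
  ext r s
  by_cases hrs : r = s
  · subst hrs
    simpa using hconst r r.isLt
  · simp [hdiag r s hrs, hrs]

/-- If `U` normalizes `X` up to a scalar, where `U ^ 3` is scalar and `X ^ d = 1` with `d` coprime
to `3`, then `U` and `X` commute. -/
lemma commute_of_mul_eq_smul_mul {n : Type*} [Fintype n] [DecidableEq n] [Nonempty n]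
    {U X : Matrix n n ℂ} (hU : IsUnit U.det) (hd : d ≠ 0) (hd3 : d.Coprime 3) (hX : X ^ d = 1)
    (h3 : ∃ c : ℂ, U ^ 3 = c • (1 : Matrix n n ℂ)) {ε : ℂ} (h : U * X = ε • (X * U)) :
    Commute U X := by
  have hne {A : Matrix n n ℂ} (hA : IsUnit A.det) : A ≠ 0 := by
    rintro rfl
    simp at hA
  have hXu := isUnit_det_of_pow_eq_one hd hX
  have hpow (k : ℕ) : U * X ^ k = ε ^ k • (X ^ k * U) := by
    induction k with
    | zero => simp
    | succ k ih =>
      rw [pow_succ, ← mul_assoc, ih, Matrix.smul_mul, mul_assoc, h, Matrix.mul_smul, smul_smul,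
        ← pow_succ, mul_assoc]
  have hεd : ε ^ d = 1 := by
    have := hpow d
    rw [hX, mul_one, one_mul] at this
    exact smul_left_injective ℂ (hne hU) (by simpa using this.symm)
  have hpow' (k : ℕ) : U ^ k * X = ε ^ k • (X * U ^ k) := by
    induction k with
    | zero => simp
    | succ k ih =>
      rw [pow_succ', mul_assoc, ih, Matrix.mul_smul, ← mul_assoc, h, Matrix.smul_mul, smul_smul,
        ← pow_succ, mul_assoc]
  have hε3 : ε ^ 3 = 1 := by
    obtain ⟨c, hc⟩ := h3
    have hu : IsUnit (X * U ^ 3).det := by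
      rw [Matrix.det_mul, Matrix.det_pow]
      exact hXu.mul (hU.pow 3)
    have hcomm : U ^ 3 * X = X * U ^ 3 := by simp [hc]
    have := hpow' 3
    rw [hcomm] at this
    exact smul_left_injective ℂ (hne hu) (by simpa using this.symm)
  have hε : ε = 1 := by
    have := pow_gcd_eq_one.mpr ⟨hεd, hε3⟩
    rwa [hd3, pow_one] at this
  rwa [hε, one_smul] at h

/-- A `2 × 2` matrix of determinant one and order dividing three over a field either has trace
`-1` or is the identity. -/
lemma trace_eq_neg_one_or_eq_one_of_cube {K : Type*} [Field K] {a b c e : K}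
    (hdet : a * e - b * c = 1)
    (h11 : a * (a * a + b * c) + b * (c * a + e * c) = 1)
    (h21 : c * (a * a + b * c) + e * (c * a + e * c) = 0)
    (h12 : a * (a * b + b * e) + b * (c * b + e * e) = 0)
    (h22 : c * (a * b + b * e) + e * (c * b + e * e) = 1) :
    a + e = -1 ∨ (a = 1 ∧ b = 0 ∧ c = 0 ∧ e = 1) := by
  by_cases ht : a + e + 1 = 0
  · exact Or.inl (by linear_combination ht)
  right
  have ha : (a + e - 1) * a = 1 := by
    apply mul_left_cancel₀ ht
    linear_combination h11 + (2 * a + e) * hdet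
  have he : (a + e - 1) * e = 1 := by
    apply mul_left_cancel₀ ht
    linear_combination h22 + (2 * e + a) * hdet
  have hs : a + e - 1 ≠ 0 := left_ne_zero_of_mul_eq_one ha
  have hb : b = 0 := by
    apply mul_left_cancel₀ (mul_ne_zero ht hs)
    linear_combination h12 + b * hdet
  have hc : c = 0 := by
    apply mul_left_cancel₀ (mul_ne_zero ht hs)
    linear_combination h21 + c * hdet
  obtain rfl : a = e := mul_left_cancel₀ hs (ha.trans he.symm)
  subst hb
  have ha1 : a = 1 := by linear_combination 2 * hdet - ha
  exact ⟨ha1, rfl, hc, ha1⟩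

end Clifford

/-- Let `d` be prime, `d ≠ 3`, and let the unitary `U` implement the
Clifford operation `[F,χ]` where `det F ≡ 1 (mod d̄)`.  If the Clifford operation
determined by `U` has order 3 (`U³` scalar, `U` and `U²` not scalar) then
`trace F ≡ −1 (mod d)`. -/
theorem stmt13 (d : ℕ) (hp : d.Prime) (hd3 : d ≠ 3)
    (U : Matrix (Fin d) (Fin d) ℂ) (hU : U ∈ Matrix.unitaryGroup (Fin d) ℂ)
    (F : Matrix (Fin 2) (Fin 2) ℤ) (χ : ℤ × ℤ)
    (hdet : F.det ≡ 1 [ZMOD (dbar d)])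
    (hconj : ∀ p : ℤ × ℤ,
      U * Dmat d p * Uᴴ = omega d ^ symp χ (Fapp F p) • Dmat d (Fapp F p))
    (h3 : ∃ c : ℂ, U ^ 3 = c • (1 : Matrix (Fin d) (Fin d) ℂ))
    (h1 : ¬ (∃ c : ℂ, U = c • (1 : Matrix (Fin d) (Fin d) ℂ)))
    (h2 : ¬ (∃ c : ℂ, U ^ 2 = c • (1 : Matrix (Fin d) (Fin d) ℂ))) :
    F.trace ≡ -1 [ZMOD (d : ℕ)] := by
  have : NeZero d := ⟨hp.ne_zero⟩
  have : Fact d.Prime := ⟨hp⟩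
  have hUU : Uᴴ * U = 1 := Matrix.mem_unitaryGroup_iff'.mp hU
  have hUdet : IsUnit U.det := Matrix.isUnit_det_of_left_inverse hUU
  have hmul (p : ℤ × ℤ) : ∃ z : ℂ, U * Dmat d p = z • (Dmat d (Fapp F p) * U) := by
    refine ⟨omega d ^ symp χ (Fapp F p), ?_⟩
    rw [← Matrix.smul_mul, ← hconj, mul_assoc, hUU, mul_one]
  have hcube (p : ℤ × ℤ) : ∃ z : ℂ, Dmat d p = z • Dmat d (Fapp F (Fapp F (Fapp F p))) := by
    obtain ⟨z₁, hz₁⟩ := hmul p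
    obtain ⟨z₂, hz₂⟩ := hmul (Fapp F p)
    obtain ⟨z₃, hz₃⟩ := hmul (Fapp F (Fapp F p))
    refine ⟨z₁ * z₂ * z₃, ?_⟩
    obtain ⟨c, hc⟩ := h3
    have hU3 : IsUnit (U ^ 3).det := by
      rw [Matrix.det_pow]
      exact hUdet.pow 3
    apply ((Matrix.isUnit_iff_isUnit_det _).mpr hU3).mul_right_cancel
    calc Dmat d p * U ^ 3 = U ^ 3 * Dmat d p := by simp [hc]
      _ = U * (U * (U * Dmat d p)) := by noncomm_ring
      _ = (z₁ * z₂ * z₃) • (Dmat d (Fapp F (Fapp F (Fapp F p))) * U * U * U) := by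
        rw [hz₁, Matrix.mul_smul, ← mul_assoc, hz₂, Matrix.mul_smul, Matrix.smul_mul,
          Matrix.mul_smul, ← mul_assoc, ← mul_assoc, hz₃]
        simp only [Matrix.smul_mul, smul_smul, mul_assoc z₁]
      _ = (z₁ * z₂ * z₃) • Dmat d (Fapp F (Fapp F (Fapp F p))) * U ^ 3 := by
        simp only [Matrix.smul_mul, mul_assoc, pow_succ, pow_zero, one_mul]
  have hdvd : (d : ℤ) ∣ dbar d := by
    rw [dbar]
    split_ifs <;> simp
  have hdet' : (F 0 0 * F 1 1 - F 0 1 * F 1 0 : ZMod d) = 1 := by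
    have := (ZMod.intCast_eq_intCast_iff _ _ d).mpr (hdet.of_dvd hdvd)
    rw [Matrix.det_fin_two] at this
    simpa using this
  obtain ⟨z, hz⟩ := hcube (1, 0)
  obtain ⟨h11, h21⟩ := intCast_eq_of_Dmat_eq_smul hz
  obtain ⟨w, hw⟩ := hcube (0, 1)
  obtain ⟨h12, h22⟩ := intCast_eq_of_Dmat_eq_smul hw
  simp only [Fapp, mul_one, mul_zero, add_zero, zero_add, Int.cast_add, Int.cast_mul,
    Int.cast_one, Int.cast_zero] at h11 h21 h12 h22
  rcases trace_eq_neg_one_or_eq_one_of_cube hdet' h11.symm h21.symm h12.symm h22.symm with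
    ht | ⟨ha, hb, hc, he⟩
  · rw [← ZMod.intCast_eq_intCast_iff, Matrix.trace_fin_two]
    simpa using ht
  · refine absurd ?_ h1
    have hd3' : d.Coprime 3 := (Nat.coprime_primes hp Nat.prime_three).mpr hd3
    have hS : Dmat d (1, 0) = Smat d := by simp [Dmat]
    have hT : Dmat d (0, 1) = Tmat d := by simp [Dmat]
    apply exists_eq_smul_one_of_commute
    · obtain ⟨ε, hε⟩ := hmul (1, 0)
      have hSF : Smat d ^ F 0 0 = Smat d ^ (1 : ℤ) :=
        Matrix.zpow_eq_of_intCast_eq hp.ne_zero Smat_pow (by simpa using ha)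
      have hTF : Tmat d ^ F 1 0 = Tmat d ^ (0 : ℤ) :=
        Matrix.zpow_eq_of_intCast_eq hp.ne_zero (Tmat_pow hp.ne_zero) (by simpa using hc)
      rw [hS] at hε
      simp only [Dmat, Fapp, mul_one, mul_zero, add_zero, hSF, hTF, zpow_zero, zpow_one,
        Matrix.smul_mul, smul_smul] at hε
      exact commute_of_mul_eq_smul_mul hUdet hp.ne_zero hd3' Smat_pow h3 hε
    · obtain ⟨ε, hε⟩ := hmul (0, 1)
      have hSF : Smat d ^ F 0 1 = Smat d ^ (0 : ℤ) :=
        Matrix.zpow_eq_of_intCast_eq hp.ne_zero Smat_pow (by simpa using hb)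
      have hTF : Tmat d ^ F 1 1 = Tmat d ^ (1 : ℤ) :=
        Matrix.zpow_eq_of_intCast_eq hp.ne_zero (Tmat_pow hp.ne_zero) (by simpa using he)
      rw [hT] at hε
      simp only [Dmat, Fapp, mul_one, mul_zero, zero_add, hSF, hTF, zpow_zero, zpow_one, one_mul,
        Matrix.smul_mul, smul_smul] at hε
      exact commute_of_mul_eq_smul_mul hUdet hp.ne_zero hd3' (Tmat_pow hp.ne_zero) h3 hε
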